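/- The group SL(2,ℤ) admits the presentation ⟨x, y | x²y³, x⁴⟩; equivalently, the group with presentation ⟨x, y | x²y³, x⁴⟩ is isomorphic to SL(2,ℤ), with x mapping to S = [[0,-1],[1,0]] and y mapping to (ST)⁻¹ where T = [[1,1],[0,1]]. -/

import Mathlib

/-- The matrix `S = [[0,-1],[1,0]]` in `SL(2,ℤ)`. -/
def Smat : Matrix.SpecialLinearGroup (Fin 2) ℤ :=
  ⟨!![0, -1; 1, 0], by norm_num [Matrix.det_fin_two_of]⟩

/-- The matrix `T = [[1,1],[0,1]]` in `SL(2,ℤ)`. -/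
def Tmat : Matrix.SpecialLinearGroup (Fin 2) ℤ :=
  ⟨!![1, 1; 0, 1], by norm_num [Matrix.det_fin_two_of]⟩

/-- Words in `y x` and `y² x`. -/
inductive SLWord {G : Type*} [Group G] (x y : G) : G → Prop
  | one : SLWord x y 1
  | p (m : G) : SLWord x y m → SLWord x y (y * x * m)
  | q (m : G) : SLWord x y m → SLWord x y (y * y * x * m)

/-- Normal form. -/
def SLNF {G : Type*} [Group G] (x y : G) (g : G) : Prop :=
  ∃ c a m b : G, (c = 1 ∨ c = x * x) ∧ (a = 1 ∨ a = x) ∧ SLWord x y m ∧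
    (b = 1 ∨ b = y ∨ b = y * y) ∧ g = c * (a * (m * b))

section nf
variable {G : Type*} [Group G] {x y : G}

theorem SLNF.z_mul (hx : x * x * (x * x) = 1) {g : G} (h : SLNF x y g) :
    SLNF x y (x * x * g) := by
  obtain ⟨c, a, m, b, hc, ha, hm, hb, rfl⟩ := h
  rcases hc with rfl | rfl
  · exact ⟨x * x, a, m, b, Or.inr rfl, ha, hm, hb, by simp⟩
  · refine ⟨1, a, m, b, Or.inl rfl, ha, hm, hb, ?_⟩
    rw [← mul_assoc (x * x) (x * x), hx]

theorem SLNF.c_mul (hx : x * x * (x * x) = 1) {c g : G} (hc : c = 1 ∨ c = x * x)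
    (h : SLNF x y g) : SLNF x y (c * g) := by
  rcases hc with rfl | rfl
  · simpa using h
  · exact h.z_mul hx

theorem SLNF.x_mul (hx : x * x * (x * x) = 1) {g : G} (h : SLNF x y g) :
    SLNF x y (x * g) := by
  obtain ⟨c, a, m, b, hc, ha, hm, hb, rfl⟩ := h
  have h1 : x * (c * (a * (m * b))) = c * (x * (a * (m * b))) := by
    rcases hc with rfl | rfl <;> simp [mul_assoc]
  rw [h1]
  apply SLNF.c_mul hx hc
  rcases ha with rfl | rfl
  · exact ⟨1, x, m, b, Or.inl rfl, Or.inr rfl, hm, hb, by simp⟩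
  · exact ⟨a * a, 1, m, b, Or.inr rfl, Or.inl rfl, hm, hb, by simp [mul_assoc]⟩

theorem SLNF.y_mul (hx : x * x * (x * x) = 1) (hy : y * (y * y) = x * x) {g : G}
    (h : SLNF x y g) : SLNF x y (y * g) := by
  obtain ⟨c, a, m, b, hc, ha, hm, hb, rfl⟩ := h
  have h1 : y * (c * (a * (m * b))) = c * (y * (a * (m * b))) := by
    rcases hc with rfl | rfl
    · simp
    · rw [← hy]; simp [mul_assoc]
  rw [h1]
  apply SLNF.c_mul hx hc
  rcases ha with rfl | rfl
  · cases hm with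
    | one =>
      rcases hb with rfl | rfl | rfl
      · exact ⟨1, 1, 1, y, by simp, by simp, .one, by simp, by simp⟩
      · exact ⟨1, 1, 1, b * b, by simp, by simp, .one, by simp, by simp⟩
      · exact ⟨x * x, 1, 1, 1, by simp, by simp, .one, by simp, by simp [hy]⟩
    | p m hm =>
      exact ⟨1, 1, _, b, by simp, by simp, .q m hm, hb, by simp [mul_assoc]⟩
    | q m hm =>
      refine ⟨x * x, x, m, b, by simp, by simp, hm, hb, ?_⟩
      rw [← hy]; simp [mul_assoc]
  · exact ⟨1, 1, _, b, by simp, by simp, .p m hm, hb, by simp [mul_assoc]⟩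

end nf

theorem sl_entries : (Smat 0 0 = 0 ∧ Smat 0 1 = -1 ∧ Smat 1 0 = 1 ∧ Smat 1 1 = 0) ∧
    (Tmat 0 0 = 1 ∧ Tmat 0 1 = 1 ∧ Tmat 1 0 = 0 ∧ Tmat 1 1 = 1) := by
  decide

theorem SLWord.image {G : Type*} [Group G] {x y : G}
    (f : G →* Matrix.SpecialLinearGroup (Fin 2) ℤ)
    (hx : f x = Smat) (hy : f y = (Smat * Tmat)⁻¹) {m : G} (h : SLWord x y m) :
    1 ≤ f m 0 0 ∧ 1 ≤ f m 1 1 ∧ f m 0 1 ≤ 0 ∧ f m 1 0 ≤ 0 ∧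
      (m = 1 ∨ f m 0 1 + f m 1 0 ≤ -1) := by
  induction h with
  | one => simp
  | p m hm ih =>
    obtain ⟨h1, h2, h3, h4, -⟩ := ih
    have e : f (y * x * m) = Tmat⁻¹ * f m := by simp [hx, hy]
    rw [e]
    simp [sl_entries, Matrix.SpecialLinearGroup.coe_inv, Matrix.adjugate_fin_two, Matrix.mul_apply,
      Fin.sum_univ_two]
    refine ⟨by linarith, h2, by linarith, h4, Or.inr (by linarith)⟩
  | q m hm ih =>
    obtain ⟨h1, h2, h3, h4, -⟩ := ih
    have e : f (y * y * x * m) = Tmat⁻¹ * Smat⁻¹ * Tmat⁻¹ * f m := by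
      simp [hx, hy, mul_assoc]
    rw [e]
    simp [Matrix.SpecialLinearGroup.coe_inv, sl_entries,
      Matrix.adjugate_fin_two,
      Matrix.mul_apply, Fin.sum_univ_two]
    refine ⟨h1, by linarith, h3, by linarith, Or.inr (by linarith)⟩

theorem SLNF.eq_one {G : Type*} [Group G] {x y : G}
    (f : G →* Matrix.SpecialLinearGroup (Fin 2) ℤ)
    (hx : f x = Smat) (hy : f y = (Smat * Tmat)⁻¹) {g : G} (h : SLNF x y g)
    (hg : f g = 1) : g = 1 := by
  obtain ⟨c, a, m, b, hc, ha, hm, hb, rfl⟩ := h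
  obtain ⟨h1, h2, h3, h4, h5⟩ := hm.image f hx hy
  have key : f m = (f a)⁻¹ * (f c)⁻¹ * (f b)⁻¹ := by
    simp only [map_mul] at hg
    rw [← mul_inv_rev, ← mul_inv_rev, eq_inv_iff_mul_eq_one, ← mul_assoc]
    have := congrArg (fun t => f b * t * (f b)⁻¹) hg
    have h6 : f m * (f b * (f c * f a)) = (f c * f a)⁻¹ * (f c * (f a * (f m * f b)))
        * (f c * f a) := by group
    rw [mul_assoc, h6, hg]; group
  have k00 := congrArg (fun M : Matrix.SpecialLinearGroup (Fin 2) ℤ => M 0 0) key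
  have k01 := congrArg (fun M : Matrix.SpecialLinearGroup (Fin 2) ℤ => M 0 1) key
  have k10 := congrArg (fun M : Matrix.SpecialLinearGroup (Fin 2) ℤ => M 1 0) key
  have k11 := congrArg (fun M : Matrix.SpecialLinearGroup (Fin 2) ℤ => M 1 1) key
  clear key
  rcases hc with rfl | rfl <;> rcases ha with rfl | rfl <;> rcases hb with rfl | rfl | rfl <;>
    simp [hx, hy, Matrix.SpecialLinearGroup.coe_inv, sl_entries,
      Matrix.adjugate_fin_two,
      Matrix.mul_apply, Fin.sum_univ_two] at k00 k01 k10 k11 <;>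
    first
    | (exfalso; omega)
    | (rcases h5 with rfl | h5
       · simp
       · exfalso; omega)

/-- `SL(2,ℤ)` has the presentation `⟨x, y | x²y³, x⁴⟩`, with `x ↦ S` and `y ↦ (ST)⁻¹`. -/
theorem sl2z_presentation :
    ∃ e : PresentedGroup
        ({(FreeGroup.of 0 : FreeGroup (Fin 2)) ^ 2 * FreeGroup.of 1 ^ 3,
          (FreeGroup.of 0 : FreeGroup (Fin 2)) ^ 4}) ≃*
        Matrix.SpecialLinearGroup (Fin 2) ℤ,
      e (PresentedGroup.of 0) = Smat ∧ e (PresentedGroup.of 1) = (Smat * Tmat)⁻¹ := by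
  set R : Set (FreeGroup (Fin 2)) := {(FreeGroup.of 0 : FreeGroup (Fin 2)) ^ 2 * FreeGroup.of 1 ^ 3,
          (FreeGroup.of 0 : FreeGroup (Fin 2)) ^ 4} with hR
  let v : Fin 2 → Matrix.SpecialLinearGroup (Fin 2) ℤ := ![Smat, (Smat * Tmat)⁻¹]
  have hv : ∀ r ∈ R, FreeGroup.lift v r = 1 := by
    rintro r (rfl | rfl)
    · simp only [map_mul, map_pow, FreeGroup.lift_apply_of, v]
      decide
    · simp only [map_pow, FreeGroup.lift_apply_of, v]
      decide
  let f : PresentedGroup R →* Matrix.SpecialLinearGroup (Fin 2) ℤ := PresentedGroup.toGroup hv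
  have fx : f (PresentedGroup.of 0) = Smat := PresentedGroup.toGroup.of hv
  have fy : f (PresentedGroup.of 1) = (Smat * Tmat)⁻¹ := PresentedGroup.toGroup.of hv
  set x : PresentedGroup R := PresentedGroup.of 0 with hxdef
  set y : PresentedGroup R := PresentedGroup.of 1 with hydef
  have r1 : x ^ 2 * y ^ 3 = 1 :=
    PresentedGroup.one_of_mem (rels := R) (x := FreeGroup.of 0 ^ 2 * FreeGroup.of 1 ^ 3)
      (by simp [hR])
  have r2 : x ^ 4 = 1 :=
    PresentedGroup.one_of_mem (rels := R) (x := FreeGroup.of 0 ^ 4) (by simp [hR])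
  have hx : x * x * (x * x) = 1 := by rw [← r2]; simp only [pow_succ, pow_zero, one_mul, mul_assoc]
  have hy : y * (y * y) = x * x := by
    have e1 : y * (y * y) = y ^ 3 := by simp only [pow_succ, pow_zero, one_mul, mul_assoc]
    have e2 : x * x = x ^ 2 := by simp only [pow_succ, pow_zero, one_mul, mul_assoc]
    rw [e1, e2, ← mul_right_inj (x ^ 2), r1, ← r2]; group
  have nf : ∀ g : PresentedGroup R, SLNF x y g := by
    have hx3 : x⁻¹ = x * (x * x) := by
      rw [inv_eq_iff_mul_eq_one, ← hx]; group
    have hy5 : y⁻¹ = x * (x * (y * y)) := by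
      rw [inv_eq_iff_mul_eq_one, ← mul_assoc x x, ← hy, ← hx, ← hy]; group
    intro g
    have hg : g ∈ Subgroup.closure (Set.range (PresentedGroup.of : Fin 2 → PresentedGroup R)) := by
      rw [PresentedGroup.closure_range_of]; trivial
    induction hg using Subgroup.closure_induction_left with
    | one => exact ⟨1, 1, 1, 1, by simp, by simp, .one, by simp, by simp⟩
    | mul_left s hs g _ ih =>
      obtain ⟨i, rfl⟩ := hs
      fin_cases i
      · exact ih.x_mul hx
      · exact ih.y_mul hx hy
    | inv_mul_cancel s hs g _ ih =>
      obtain ⟨i, rfl⟩ := hs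
      fin_cases i
      · change SLNF x y (x⁻¹ * g)
        rw [hx3]; simp only [mul_assoc]
        exact ((ih.x_mul hx).x_mul hx).x_mul hx
      · change SLNF x y (y⁻¹ * g)
        rw [hy5]; simp only [mul_assoc]
        exact (((ih.y_mul hx hy).y_mul hx hy).x_mul hx).x_mul hx
  have inj : Function.Injective f := by
    rw [injective_iff_map_eq_one]
    intro g hg
    exact (nf g).eq_one f fx fy hg
  have surj : Function.Surjective f := by
    rw [← MonoidHom.range_eq_top, eq_top_iff, ← SpecialLinearGroup.SL2Z_generators,
      Subgroup.closure_le]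
    rintro s (rfl | rfl)
    · exact ⟨x, fx⟩
    · refine ⟨x⁻¹ * y⁻¹, ?_⟩
      rw [map_mul, map_inv, map_inv, fx, fy, inv_inv, inv_mul_cancel_left]
      rfl
  exact ⟨MulEquiv.ofBijective f ⟨inj, surj⟩, fx, fy⟩
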